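/- arXiv:2509.11632 — 3 statements merged into one kernel-verified Lean document; each statement's English description precedes it below -/
import Mathlib

section
/- With Δ, c, d_j, h, g, F as specified: for every λ ∈ Δ, the sum s := Σ_a c a · λ a is strictly positive, the pair (y, z) with y := (λ a / s)_{a∈𝒜} and z := 1/s belongs to the feasible set F, and g(y) = h(λ). -/
/-- Forward direction of the paper's Lemma 1. For every λ in the
simplex, s = Σ_a c a · λ a > 0, the pair (λ/s, 1/s) is feasible for the
transformed program, and the objective values agree: g(λ/s) = h(λ). -/
theorem charnes_cooper_forward
    {α J : Type*} [Fintype α] [Nonempty α] [Fintype J] [Nonempty J]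
    (c : α → ℝ) (hc : ∀ a, 0 < c a) (d : J → α → ℝ)
    (Δ : Set (α → ℝ)) (hΔ : Δ = {l | (∀ a, 0 ≤ l a) ∧ ∑ a, l a = 1})
    (h : (α → ℝ) → ℝ)
    (hh : h = fun l =>
      (Finset.univ.inf' Finset.univ_nonempty fun j => ∑ a, d j a * l a) /
        ∑ a, c a * l a)
    (g : (α → ℝ) → ℝ)
    (hg : g = fun y =>
      Finset.univ.inf' Finset.univ_nonempty fun j => ∑ a, d j a * y a)
    (F : Set ((α → ℝ) × ℝ))
    (hF : F = {p | (∀ a, 0 ≤ p.1 a) ∧ 0 ≤ p.2 ∧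
      (∑ a, p.1 a) = p.2 ∧ (∑ a, c a * p.1 a) = 1}) :
    ∀ l ∈ Δ, 0 < (∑ a, c a * l a) ∧
      ((fun a => l a / (∑ a, c a * l a)), 1 / (∑ a, c a * l a)) ∈ F ∧
      g (fun a => l a / (∑ a, c a * l a)) = h l := by
  subst hΔ hh hg hF
  rintro l ⟨hl, hl1⟩
  have hs : 0 < ∑ a, c a * l a := by
    have hne : ∃ a, l a ≠ 0 := by
      by_contra! hcon
      simp [hcon] at hl1
    obtain ⟨a, ha⟩ := hne
    exact Finset.sum_pos' (fun i _ => mul_nonneg (hc i).le (hl i))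
      ⟨a, Finset.mem_univ a, mul_pos (hc a) (lt_of_le_of_ne (hl a) (Ne.symm ha))⟩
  refine ⟨hs, ?_, ?_⟩
  · generalize hS : (∑ a, c a * l a) = s at hs
    refine ⟨fun a => div_nonneg (hl a) hs.le, by positivity, ?_, ?_⟩
    · change ∑ a, l a / s = 1 / s
      rw [← Finset.sum_div, hl1]
    · change ∑ a, c a * (l a / s) = 1
      simp_rw [← mul_div_assoc]
      rw [← Finset.sum_div, hS, div_self hs.ne']
  · beta_reduce
    generalize (∑ a, c a * l a) = s at hs
    simp only [← mul_div_assoc, ← Finset.sum_div]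
    have hm : Monotone (fun x : ℝ => x / s) := fun x y hxy =>
      div_le_div_of_nonneg_right hxy hs.le
    exact (Finset.apply_inf'_eq_inf'_comp (Finset.univ_nonempty (α := J)) (f := fun j => ∑ a, d j a * l a)
      (fun x : ℝ => x / s)
      (fun x y => hm.map_inf x y)).symm
end

section
/- With Δ, c, d_j, h, g, F as specified: for every (y, z) ∈ F one has z > 0, the vector λ := (y a / z)_{a∈𝒜} belongs to the simplex Δ, and h(λ) = g(y). -/
/-- Backward direction of the paper's Lemma 1. For every feasible
pair (y, z) ∈ F, z > 0, the vector λ = y/z lies in the simplex Δ, and the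
objective values agree: h(y/z) = g(y). -/
theorem charnes_cooper_backward
    {α J : Type*} [Fintype α] [Nonempty α] [Fintype J] [Nonempty J]
    (c : α → ℝ) (hc : ∀ a, 0 < c a) (d : J → α → ℝ)
    (Δ : Set (α → ℝ)) (hΔ : Δ = {l | (∀ a, 0 ≤ l a) ∧ ∑ a, l a = 1})
    (h : (α → ℝ) → ℝ)
    (hh : h = fun l =>
      (Finset.univ.inf' Finset.univ_nonempty fun j => ∑ a, d j a * l a) /
        ∑ a, c a * l a)
    (g : (α → ℝ) → ℝ)
    (hg : g = fun y =>
      Finset.univ.inf' Finset.univ_nonempty fun j => ∑ a, d j a * y a)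
    (F : Set ((α → ℝ) × ℝ))
    (hF : F = {p | (∀ a, 0 ≤ p.1 a) ∧ 0 ≤ p.2 ∧
      (∑ a, p.1 a) = p.2 ∧ (∑ a, c a * p.1 a) = 1}) :
    ∀ y : α → ℝ, ∀ z : ℝ, (y, z) ∈ F →
      0 < z ∧ (fun a => y a / z) ∈ Δ ∧ h (fun a => y a / z) = g y := by
  subst hΔ hh hg hF
  rintro y z ⟨hy, hz, hs, hcy⟩
  dsimp only at hy hz hs hcy
  have hzpos : 0 < z := by
    rcases hz.lt_or_eq with h0 | h0
    · exact h0
    · exfalso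
      rw [← h0, Finset.sum_eq_zero_iff_of_nonneg (fun a _ => hy a)] at hs
      rw [Finset.sum_eq_zero (fun a ha => by rw [hs a ha, mul_zero])] at hcy
      exact zero_ne_one hcy
  refine ⟨hzpos, ⟨fun a => div_nonneg (hy a) hz, ?_⟩, ?_⟩
  · rw [← Finset.sum_div, hs, div_self hzpos.ne']
  · have key := Finset.apply_inf'_eq_inf'_comp (s := Finset.univ) Finset.univ_nonempty
      (f := fun j => ∑ a, d j a * y a) (fun x : ℝ => x / z)
      (fun x w => (min_div_div_right hz x w).symm)
    simp only [Function.comp_def] at key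
    simp only [← mul_div_assoc, ← Finset.sum_div, hcy]
    rw [← key]
    field_simp
end

section
/- With Δ, c, d_j, h, g, F as specified: if λ* ∈ Δ satisfies h(λ*) ≥ h(λ) for every λ ∈ Δ, then with s := Σ_a c a · λ* a, the pair (y*, z*) := ((λ* a / s)_{a∈𝒜}, 1/s) lies in F and maximizes the linear objective: g(y*) ≥ g(y) for every (y, z) ∈ F. -/
theorem aux_inf_div {α J : Type*} [Fintype α] [Fintype J] [Nonempty J]
    (d : J → α → ℝ) (y : α → ℝ) (t : ℝ) (ht : 0 < t) :
    (Finset.univ.inf' Finset.univ_nonempty fun j => ∑ a, d j a * (y a / t)) =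
      (Finset.univ.inf' Finset.univ_nonempty fun j => ∑ a, d j a * y a) / t := by
  have e : ∀ j, ∑ a, d j a * (y a / t) = (∑ a, d j a * y a) / t := by
    intro j
    rw [Finset.sum_div]
    exact Finset.sum_congr rfl fun a _ => by ring
  simp only [e]
  apply le_antisymm
  · rw [le_div_iff₀ ht]
    refine Finset.le_inf' _ _ fun j hj => ?_
    rw [← le_div_iff₀ ht]
    exact Finset.inf'_le (fun j => (∑ a, d j a * y a) / t) hj
  · refine Finset.le_inf' _ _ fun j hj => ?_
    exact div_le_div_of_nonneg_right (Finset.inf'_le (fun j => ∑ a, d j a * y a) hj) ht.le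

theorem aux_pos {α : Type*} [Fintype α] (c l : α → ℝ) (hc : ∀ a, 0 < c a)
    (hl : ∀ a, 0 ≤ l a) (h1 : ∑ a, l a ≠ 0) : 0 < ∑ a, c a * l a := by
  obtain ⟨a, -, ha⟩ := Finset.exists_ne_zero_of_sum_ne_zero h1
  exact Finset.sum_pos' (fun a _ => mul_nonneg (hc a).le (hl a))
    ⟨a, Finset.mem_univ a, mul_pos (hc a) (lt_of_le_of_ne (hl a) (Ne.symm ha))⟩

/-- Converse optimizer correspondence of the paper's Lemma 1. If
λ* maximizes the fractional objective h over Δ, then with s = Σ_a c a · λ* a,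
the pair (λ*/s, 1/s) is feasible and maximizes the linear objective g over F. -/
theorem optimal_solution_transfer_converse
    {α J : Type*} [Fintype α] [Nonempty α] [Fintype J] [Nonempty J]
    (c : α → ℝ) (hc : ∀ a, 0 < c a) (d : J → α → ℝ)
    (Δ : Set (α → ℝ)) (hΔ : Δ = {l | (∀ a, 0 ≤ l a) ∧ ∑ a, l a = 1})
    (h : (α → ℝ) → ℝ)
    (hh : h = fun l =>
      (Finset.univ.inf' Finset.univ_nonempty fun j => ∑ a, d j a * l a) /
        ∑ a, c a * l a)
    (g : (α → ℝ) → ℝ)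
    (hg : g = fun y =>
      Finset.univ.inf' Finset.univ_nonempty fun j => ∑ a, d j a * y a)
    (F : Set ((α → ℝ) × ℝ))
    (hF : F = {p | (∀ a, 0 ≤ p.1 a) ∧ 0 ≤ p.2 ∧
      (∑ a, p.1 a) = p.2 ∧ (∑ a, c a * p.1 a) = 1})
    (lstar : α → ℝ) (hmem : lstar ∈ Δ)
    (hopt : ∀ l ∈ Δ, h l ≤ h lstar) :
    ((fun a => lstar a / (∑ a, c a * lstar a)), 1 / (∑ a, c a * lstar a)) ∈ F ∧
      ∀ p ∈ F, g p.1 ≤ g (fun a => lstar a / (∑ a, c a * lstar a)) := by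
  subst hΔ hh hg hF
  obtain ⟨hl0, hl1⟩ := hmem
  have hs : 0 < ∑ a, c a * lstar a := aux_pos c lstar hc hl0 (by rw [hl1]; norm_num)
  have lin : ∀ (y : α → ℝ) (t : ℝ), ∑ a, c a * (y a / t) = (∑ a, c a * y a) / t := by
    intro y t
    rw [Finset.sum_div]
    exact Finset.sum_congr rfl fun a _ => by ring
  refine ⟨⟨fun a => div_nonneg (hl0 a) hs.le, by positivity, ?_, ?_⟩, ?_⟩
  · show ∑ a, lstar a / _ = _
    rw [← Finset.sum_div, hl1]
  · show ∑ a, c a * (lstar a / _) = _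
    rw [lin, div_self hs.ne']
  · rintro ⟨y, z⟩ ⟨hy, hz, hyz, hcy⟩
    dsimp only at hy hz hyz hcy ⊢
    have hz' : 0 < z := by
      refine lt_of_le_of_ne hz fun h0 => ?_
      rw [← h0, Finset.sum_eq_zero_iff_of_nonneg (fun a _ => hy a)] at hyz
      rw [Finset.sum_eq_zero (fun a ha => by rw [hyz a ha, mul_zero])] at hcy
      exact zero_ne_one hcy
    have := hopt (fun a => y a / z)
      ⟨fun a => div_nonneg (hy a) hz, by rw [← Finset.sum_div, hyz, div_self hz'.ne']⟩
    dsimp only at this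
    rw [aux_inf_div d y z hz', lin, hcy, div_div_div_cancel_right₀ hz'.ne', div_one] at this
    rw [aux_inf_div d lstar _ hs]
    exact this
end
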